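/- Let a linear exchange market with limit sell offers have its offers partitioned into two subfamilies O¹ and O², let V¹ and V² be the sets of assets appearing (as sold or bought asset) in O¹ and O² respectively, and suppose V¹ ∩ V² = {v} is a single asset and V¹ ∪ V² is the whole asset set. Let (p¹, λ¹) be an equilibrium of the restricted market (V¹, O¹) and (p², λ²) an equilibrium of the restricted market (V², O²). Then the combined prices p defined by p_A = p¹_A for A ∈ V¹ and p_A = (p¹_v / p²_v) · p²_A for A ∈ V², together with the combined fill fractions (λ¹ on O¹ and λ² on O²), form an equilibrium of the entire market. -/

import Mathlib

attribute [local instance] Classical.propDecidable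

/-- A linear exchange market with limit sell offers: a finite nonempty set of
assets and a finite family of offers; offer `i` sells asset `sell i` for a
distinct asset `buy i`, with endowment `endow i > 0` and limit price `limit i > 0`. -/
structure Market (Asset : Type) (I : Type) [Fintype Asset] [Fintype I] where
  sell : I → Asset
  buy : I → Asset
  endow : I → ℝ
  limit : I → ℝ
  distinct : ∀ i, sell i ≠ buy i
  endow_pos : ∀ i, 0 < endow i
  limit_pos : ∀ i, 0 < limit i

variable {Asset I : Type} [Fintype Asset] [Fintype I]

/-- `(p, lam)` is an equilibrium: prices are strictly positive, fill fractions
lie in `[0,1]`, offers strictly in the money fill fully, offers strictly out of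
the money do not fill, and each asset's amount sold equals the amount bought. -/
noncomputable def IsEquilibrium (M : Market Asset I) (p : Asset → ℝ) (lam : I → ℝ) : Prop :=
  (∀ A, 0 < p A) ∧
  (∀ i, lam i ∈ Set.Icc (0:ℝ) 1) ∧
  (∀ i, M.limit i * p (M.buy i) < p (M.sell i) → lam i = 1) ∧
  (∀ i, p (M.sell i) < M.limit i * p (M.buy i) → lam i = 0) ∧
  (∀ A, (∑ i : I, if M.sell i = A then lam i * M.endow i else 0) =
        (∑ i : I, if M.buy i = A then lam i * M.endow i * p (M.sell i) / p (M.buy i) else 0))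

/-- `tradeAmt M lam A B` is the total amount of asset `A` sold in exchange for `B`. -/
noncomputable def tradeAmt (M : Market Asset I) (lam : I → ℝ) (A B : Asset) : ℝ :=
  ∑ i : I, if M.sell i = A ∧ M.buy i = B then lam i * M.endow i else 0

/-- Equilibrium of the restricted market consisting of the subset `V` of assets
together with the subfamily `O` of offers (whose sold and bought assets lie in
`V`): prices are positive on `V`, fill fractions of offers in `O` lie in
`[0,1]` and respect limit prices, and each asset of `V` has its amount sold by
offers in `O` equal to its amount bought by offers in `O`. -/
def IsRestrictedEquilibrium (M : Market Asset I) (V : Set Asset) (O : Set I)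
    (p : Asset → ℝ) (lam : I → ℝ) : Prop :=
  (∀ A ∈ V, 0 < p A) ∧
  (∀ i ∈ O, lam i ∈ Set.Icc (0:ℝ) 1) ∧
  (∀ i ∈ O, M.limit i * p (M.buy i) < p (M.sell i) → lam i = 1) ∧
  (∀ i ∈ O, p (M.sell i) < M.limit i * p (M.buy i) → lam i = 0) ∧
  (∀ A ∈ V, (∑ i : I, if M.sell i = A ∧ i ∈ O then lam i * M.endow i else 0) =
        (∑ i : I, if M.buy i = A ∧ i ∈ O then
            lam i * M.endow i * p (M.sell i) / p (M.buy i) else 0))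

/-- The set of assets appearing (as sold or bought asset) in a subfamily `O` of
offers. -/
def assetSet (M : Market Asset I) (O : Set I) : Set Asset :=
  {A | ∃ i ∈ O, M.sell i = A ∨ M.buy i = A}

/-- A restricted equilibrium stays one after rescaling all prices by a common positive factor;
prices outside the asset set and fill fractions outside the subfamily are irrelevant. -/
theorem IsRestrictedEquilibrium.rescale {M : Market Asset I} {O : Set I} {p q : Asset → ℝ}
    {lam mu : I → ℝ} (h : IsRestrictedEquilibrium M (assetSet M O) O p lam) {c : ℝ} (hc : 0 < c)
    (hq : ∀ A ∈ assetSet M O, q A = c * p A) (hmu : ∀ i ∈ O, mu i = lam i) :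
    IsRestrictedEquilibrium M (assetSet M O) O q mu := by
  obtain ⟨hpos, hfill, hfull, hnone, hclear⟩ := h
  have hsell : ∀ i ∈ O, q (M.sell i) = c * p (M.sell i) := fun i hi =>
    hq _ ⟨i, hi, Or.inl rfl⟩
  have hbuy : ∀ i ∈ O, q (M.buy i) = c * p (M.buy i) := fun i hi =>
    hq _ ⟨i, hi, Or.inr rfl⟩
  refine ⟨fun A hA => ?_, fun i hi => ?_, fun i hi hlt => ?_, fun i hi hlt => ?_,
    fun A hA => ?_⟩
  · rw [hq A hA]
    exact mul_pos hc (hpos A hA)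
  · rw [hmu i hi]
    exact hfill i hi
  · rw [hsell i hi, hbuy i hi, mul_left_comm] at hlt
    rw [hmu i hi]
    exact hfull i hi (lt_of_mul_lt_mul_left hlt hc.le)
  · rw [hsell i hi, hbuy i hi, mul_left_comm] at hlt
    rw [hmu i hi]
    exact hnone i hi (lt_of_mul_lt_mul_left hlt hc.le)
  · convert hclear A hA using 1
    · refine Finset.sum_congr rfl fun i _ => ite_congr rfl (fun hi => ?_) fun _ => rfl
      rw [hmu i hi.2]
    · refine Finset.sum_congr rfl fun i _ => ite_congr rfl (fun hi => ?_) fun _ => rfl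
      rw [hmu i hi.2, hsell i hi.2, hbuy i hi.2, mul_left_comm, mul_div_mul_left _ _ hc.ne']

/-- Assets outside the asset set of a subfamily are not traded by it, so a restricted equilibrium
clears every asset. -/
theorem IsRestrictedEquilibrium.clears {M : Market Asset I} {O : Set I} {p : Asset → ℝ}
    {lam : I → ℝ} (h : IsRestrictedEquilibrium M (assetSet M O) O p lam) (A : Asset) :
    (∑ i : I, if M.sell i = A ∧ i ∈ O then lam i * M.endow i else 0) =
      ∑ i : I, if M.buy i = A ∧ i ∈ O then
        lam i * M.endow i * p (M.sell i) / p (M.buy i) else 0 := by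
  by_cases hA : A ∈ assetSet M O
  · exact h.2.2.2.2 A hA
  · rw [Finset.sum_eq_zero, Finset.sum_eq_zero]
    · exact fun i _ => if_neg fun hi => hA ⟨i, hi.2, Or.inr hi.1⟩
    · exact fun i _ => if_neg fun hi => hA ⟨i, hi.2, Or.inl hi.1⟩

/-- A sum over the offers satisfying a predicate splits along a partition of the offers. -/
theorem sum_ite_eq_add_of_partition {O₁ O₂ : Set I} (hdisj : Disjoint O₁ O₂)
    (hcover : O₁ ∪ O₂ = Set.univ) (P : I → Prop) (f : I → ℝ) :
    (∑ i, if P i then f i else 0) =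
      (∑ i, if P i ∧ i ∈ O₁ then f i else 0) + ∑ i, if P i ∧ i ∈ O₂ then f i else 0 := by
  rw [← Finset.sum_add_distrib]
  refine Finset.sum_congr rfl fun i _ => ?_
  obtain hi | hi : i ∈ O₁ ∪ O₂ := hcover ▸ Set.mem_univ i
  · simp [hi, Set.disjoint_left.mp hdisj hi]
  · simp [hi, Set.disjoint_right.mp hdisj hi]

/-- Prices and fill fractions that form an equilibrium of both restricted markets of a partition
of the offers form an equilibrium of the entire market. -/
theorem IsRestrictedEquilibrium.union {M : Market Asset I} {O₁ O₂ : Set I}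
    (hdisj : Disjoint O₁ O₂) (hcover : O₁ ∪ O₂ = Set.univ)
    (hVcover : assetSet M O₁ ∪ assetSet M O₂ = Set.univ) {p : Asset → ℝ} {lam : I → ℝ}
    (h₁ : IsRestrictedEquilibrium M (assetSet M O₁) O₁ p lam)
    (h₂ : IsRestrictedEquilibrium M (assetSet M O₂) O₂ p lam) :
    IsEquilibrium M p lam := by
  have hO : ∀ i, i ∈ O₁ ∨ i ∈ O₂ := Set.eq_univ_iff_forall.mp hcover
  have hA : ∀ A, A ∈ assetSet M O₁ ∨ A ∈ assetSet M O₂ := Set.eq_univ_iff_forall.mp hVcover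
  refine ⟨fun A => (hA A).elim (h₁.1 A) (h₂.1 A),
    fun i => (hO i).elim (h₁.2.1 i) (h₂.2.1 i),
    fun i => (hO i).elim (h₁.2.2.1 i) (h₂.2.2.1 i),
    fun i => (hO i).elim (h₁.2.2.2.1 i) (h₂.2.2.2.1 i), fun A => ?_⟩
  rw [sum_ite_eq_add_of_partition hdisj hcover, sum_ite_eq_add_of_partition hdisj hcover,
    h₁.clears A, h₂.clears A]

/-- gluing two equilibria along a single shared asset.  If the
offers are partitioned into `O₁` and `O₂` whose asset sets `V₁, V₂` cover all
assets and intersect in exactly one asset `v`, then rescaling the second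
equilibrium's prices by `p₁ v / p₂ v` and combining the fill fractions yields
an equilibrium of the entire market. -/
theorem glue_equilibria_along_shared_asset {Asset I : Type} [Fintype Asset]
    [Nonempty Asset] [Fintype I] (M : Market Asset I)
    (O₁ O₂ : Set I) (hdisj : Disjoint O₁ O₂) (hcover : O₁ ∪ O₂ = Set.univ)
    (v : Asset)
    (hV : assetSet M O₁ ∩ assetSet M O₂ = {v})
    (hVcover : assetSet M O₁ ∪ assetSet M O₂ = Set.univ)
    (p₁ : Asset → ℝ) (lam₁ : I → ℝ)
    (h₁ : IsRestrictedEquilibrium M (assetSet M O₁) O₁ p₁ lam₁)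
    (p₂ : Asset → ℝ) (lam₂ : I → ℝ)
    (h₂ : IsRestrictedEquilibrium M (assetSet M O₂) O₂ p₂ lam₂) :
    IsEquilibrium M
      (fun A => if A ∈ assetSet M O₁ then p₁ A else (p₁ v / p₂ v) * p₂ A)
      (fun i => if i ∈ O₁ then lam₁ i else lam₂ i) := by
  have hv : v ∈ assetSet M O₁ ∩ assetSet M O₂ := hV ▸ Set.mem_singleton v
  have hv₂ : 0 < p₂ v := h₂.1 v hv.2
  refine IsRestrictedEquilibrium.union hdisj hcover hVcover
    (h₁.rescale one_pos (fun A hA => ?_) fun i hi => if_pos hi)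
    (h₂.rescale (div_pos (h₁.1 v hv.1) hv₂) (fun A hA => ?_)
      fun i hi => if_neg (Set.disjoint_right.mp hdisj hi))
  · rw [if_pos hA, one_mul]
  · by_cases hA₁ : A ∈ assetSet M O₁
    · obtain rfl : A = v := hV.subset ⟨hA₁, hA⟩
      rw [if_pos hA₁, div_mul_cancel₀ _ hv₂.ne']
    · exact if_neg hA₁
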